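/- In the binary setting of Gutman's test with confidence (threshold λ, training sets of size N = αn, finite alphabet X), the probability that the prediction set contains both hypotheses satisfies limsup_{n→∞} (1/n)·log P(|Γ_n| = 2) ≤ −min(F(P₁,P₂,α,λ), F(P₂,P₁,α,λ)), where F(P₁,P₂,α,λ) = inf{ D(Q₂‖P₂) + α·D(Q₁‖P₁) : (Q₁,Q₂) distributions on X with GJS(Q₁,Q₂,α) < λ }. -/

import Mathlib

open Filter Topology Real

/-- Relative entropy of finitely supported mass functions, with the conventions of `Real.log`. -/
noncomputable def relEnt {X : Type*} [Fintype X] (p r : X → ℝ) : ℝ :=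
  ∑ a, p a * Real.log (p a / r a)

/-- The generalized Jensen-Shannon divergence with weight `c`. -/
noncomputable def genJS {X : Type*} [Fintype X] (c : ℝ) (p q : X → ℝ) : ℝ :=
  c * relEnt p (fun a => (c * p a + q a) / (1 + c)) +
    relEnt q (fun a => (c * p a + q a) / (1 + c))

/-- The empirical distribution of a finite sequence. -/
noncomputable def empirical {X : Type*} [DecidableEq X] (m : ℕ) (x : Fin m → X) (a : X) : ℝ :=
  ((Finset.univ.filter fun i => x i = a).card : ℝ) / m

/-- The values `D(Q₂‖R₂) + c * D(Q₁‖R₁)` over pairs of distributions with `genJS c Q₁ Q₂ < lam`. -/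
def exponentValues {X : Type*} [Fintype X] (c lam : ℝ) (R₁ R₂ : X → ℝ) : Set ℝ :=
  {r | ∃ Q₁ Q₂ : X → ℝ, (∀ a, 0 ≤ Q₁ a) ∧ (∑ a, Q₁ a = 1) ∧ (∀ a, 0 ≤ Q₂ a) ∧
    (∑ a, Q₂ a = 1) ∧ genJS c Q₁ Q₂ < lam ∧ r = relEnt Q₂ R₂ + c * relEnt Q₁ R₁}

section Divergence

variable {X : Type*} [Fintype X]

theorem continuous_relEnt_left (r : X → ℝ) : Continuous fun p : X → ℝ => relEnt p r := by
  unfold relEnt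
  refine continuous_finsetSum _ fun a _ => ?_
  by_cases hr : r a = 0
  · simpa [hr] using continuous_const
  · have h : (fun p : X → ℝ => p a * Real.log (p a / r a)) =
        fun p => -Real.negMulLog (p a) - p a * Real.log (r a) := by
      funext p
      by_cases hp : p a = 0
      · simp [hp]
      · rw [Real.log_div hp hr, Real.negMulLog]; ring
    rw [h]
    exact ((Real.continuous_negMulLog.comp (continuous_apply a)).neg).sub
      ((continuous_apply a).mul continuous_const)

theorem genJS_eq_sum_negMulLog {c : ℝ} (hc : 0 < c) {p q : X → ℝ} (hp : ∀ a, 0 ≤ p a)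
    (hq : ∀ a, 0 ≤ q a) :
    genJS c p q = ∑ a, ((1 + c) * Real.negMulLog ((c * p a + q a) / (1 + c))
      - c * Real.negMulLog (p a) - Real.negMulLog (q a)) := by
  unfold genJS relEnt
  rw [Finset.mul_sum, ← Finset.sum_add_distrib]
  refine Finset.sum_congr rfl fun a _ => ?_
  have hpa := hp a
  have hqa := hq a
  have hcp : 0 ≤ c * p a := mul_nonneg hc.le hpa
  have h1c : (1 + c) ≠ 0 := by positivity
  by_cases hm : (c * p a + q a) / (1 + c) = 0
  · have h0 : c * p a + q a = 0 := by simpa [h1c] using hm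
    have hq0 : q a = 0 := by linarith
    have hp0 : p a = 0 := by
      have : c * p a = 0 := by linarith
      simpa [hc.ne'] using this
    simp [hq0, hp0]
  · have hlog : ∀ z : ℝ, z * Real.log (z / ((c * p a + q a) / (1 + c))) =
        -Real.negMulLog z - z * Real.log ((c * p a + q a) / (1 + c)) := by
      intro z
      by_cases hz : z = 0
      · simp [hz]
      · rw [Real.log_div hz hm, Real.negMulLog]; ring
    rw [hlog, hlog]
    generalize hL : Real.log ((c * p a + q a) / (1 + c)) = L
    have : Real.negMulLog ((c * p a + q a) / (1 + c)) = -((c * p a + q a) / (1 + c)) * L := by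
      rw [Real.negMulLog, hL]
    rw [this]
    field_simp
    ring

theorem genJS_self {c : ℝ} (hc : 0 < c) {p : X → ℝ} (hp : ∀ a, 0 ≤ p a) : genJS c p p = 0 := by
  rw [genJS_eq_sum_negMulLog hc hp hp]
  refine Finset.sum_eq_zero fun a _ => ?_
  have : (c * p a + p a) / (1 + c) = p a := by
    field_simp
    ring
  rw [this]; ring

/-- Contracting both arguments towards their weighted mean contracts `genJS`. -/
theorem genJS_contract_le {c : ℝ} (hc : 0 < c) {p q : X → ℝ} (hp : ∀ a, 0 ≤ p a)
    (hq : ∀ a, 0 ≤ q a) {ε : ℝ} (h0 : 0 ≤ ε) (h1 : ε ≤ 1) :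
    genJS c (fun a => (1 - ε) * p a + ε * ((c * p a + q a) / (1 + c)))
      (fun a => (1 - ε) * q a + ε * ((c * p a + q a) / (1 + c))) ≤ (1 - ε) * genJS c p q := by
  have hm : ∀ a, 0 ≤ (c * p a + q a) / (1 + c) := fun a =>
    div_nonneg (add_nonneg (mul_nonneg hc.le (hp a)) (hq a)) (by positivity)
  have hε : 0 ≤ 1 - ε := by linarith
  rw [genJS_eq_sum_negMulLog hc hp hq, genJS_eq_sum_negMulLog hc
    (fun a => add_nonneg (mul_nonneg hε (hp a)) (mul_nonneg h0 (hm a)))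
    (fun a => add_nonneg (mul_nonneg hε (hq a)) (mul_nonneg h0 (hm a))), Finset.mul_sum]
  refine Finset.sum_le_sum fun a _ => ?_
  have hmean : (c * ((1 - ε) * p a + ε * ((c * p a + q a) / (1 + c))) +
      ((1 - ε) * q a + ε * ((c * p a + q a) / (1 + c)))) / (1 + c) =
      (c * p a + q a) / (1 + c) := by
    field_simp
    ring
  rw [hmean]
  have hcv := fun z (hz : 0 ≤ z) => Real.concaveOn_negMulLog.2 (x := z)
    (y := (c * p a + q a) / (1 + c)) hz (hm a) hε h0 (by ring)
  have hcp := mul_le_mul_of_nonneg_left (hcv (p a) (hp a)) hc.le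
  have hcq := hcv (q a) (hq a)
  simp only [smul_eq_mul] at hcp hcq
  linarith

theorem bddBelow_exponentValues (c lam : ℝ) (R₁ R₂ : X → ℝ) :
    BddBelow (exponentValues c lam R₁ R₂) := by
  have hcont : Continuous fun z : (X → ℝ) × (X → ℝ) => relEnt z.2 R₂ + c * relEnt z.1 R₁ :=
    ((continuous_relEnt_left R₂).comp continuous_snd).add
      (continuous_const.mul ((continuous_relEnt_left R₁).comp continuous_fst))
  refine (((isCompact_stdSimplex ℝ X).prod (isCompact_stdSimplex ℝ X)).bddBelow_image
    hcont.continuousOn).mono ?_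
  rintro r ⟨Q₁, Q₂, h1, h1', h2, h2', -, rfl⟩
  exact ⟨(Q₁, Q₂), ⟨⟨h1, h1'⟩, ⟨h2, h2'⟩⟩, rfl⟩

/-- The infimum over the open divergence ball is also a lower bound over the closed ball. -/
theorem sInf_exponentValues_le {c lam : ℝ} (hc : 0 < c) (hlam : 0 < lam) (R₁ R₂ : X → ℝ)
    {p q : X → ℝ} (hp : p ∈ stdSimplex ℝ X) (hq : q ∈ stdSimplex ℝ X)
    (h : genJS c p q ≤ lam) :
    sInf (exponentValues c lam R₁ R₂) ≤ relEnt q R₂ + c * relEnt p R₁ := by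
  set m : X → ℝ := fun a => (c * p a + q a) / (1 + c) with hmdef
  have hm : ∀ a, 0 ≤ m a := fun a =>
    div_nonneg (add_nonneg (mul_nonneg hc.le (hp.1 a)) (hq.1 a)) (by positivity)
  have hmsum : ∑ a, m a = 1 := by
    simp only [hmdef]
    rw [← Finset.sum_div, Finset.sum_add_distrib, ← Finset.mul_sum, hp.2, hq.2, mul_one,
      add_comm, div_self (by positivity)]
  have hmix : ∀ z : X → ℝ, Continuous fun ε : ℝ => fun a => (1 - ε) * z a + ε * m a := by
    intro z; fun_prop
  have hcont : Continuous fun ε : ℝ => relEnt (fun a => (1 - ε) * q a + ε * m a) R₂ +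
      c * relEnt (fun a => (1 - ε) * p a + ε * m a) R₁ :=
    ((continuous_relEnt_left R₂).comp (hmix q)).add
      (continuous_const.mul ((continuous_relEnt_left R₁).comp (hmix p)))
  have htend := (hcont.tendsto 0).mono_left (nhdsWithin_le_nhds (s := Set.Ioi 0))
  simp only [sub_zero, one_mul, zero_mul, add_zero] at htend
  refine ge_of_tendsto htend ?_
  filter_upwards [Ioo_mem_nhdsGT (zero_lt_one' ℝ)] with ε hε
  have hε' : 0 ≤ 1 - ε := by linarith [hε.2]
  have hnn : ∀ z ∈ stdSimplex ℝ X, (∀ a, 0 ≤ (1 - ε) * z a + ε * m a) ∧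
      ∑ a, ((1 - ε) * z a + ε * m a) = 1 := by
    intro z hz
    refine ⟨fun a => add_nonneg (mul_nonneg hε' (hz.1 a)) (mul_nonneg hε.1.le (hm a)), ?_⟩
    rw [Finset.sum_add_distrib, ← Finset.mul_sum, ← Finset.mul_sum, hz.2, hmsum]; ring
  refine csInf_le (bddBelow_exponentValues c lam R₁ R₂)
    ⟨_, _, (hnn p hp).1, (hnn p hp).2, (hnn q hq).1, (hnn q hq).2, ?_, rfl⟩
  refine (genJS_contract_le hc hp.1 hq.1 hε.1.le hε.2.le).trans_lt ?_
  have := mul_le_mul_of_nonneg_left h hε'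
  nlinarith [hε.1]

/-- The exponent is lower semicontinuous in the weight, uniformly over pairs of distributions. -/
theorem eventually_lt_relEnt_add {α lam : ℝ} (hα : 0 < α) (hlam : 0 < lam) (R₁ R₂ : X → ℝ)
    {δ : ℝ} (hδ : 0 < δ) :
    ∀ᶠ c in 𝓝 α, ∀ p ∈ stdSimplex ℝ X, ∀ q ∈ stdSimplex ℝ X, genJS c p q < lam →
      sInf (exponentValues α lam R₁ R₂) - δ < relEnt q R₂ + c * relEnt p R₁ := by
  have hJ : ∀ z : (X → ℝ) × (X → ℝ), ContinuousAt (fun w : ℝ × ((X → ℝ) × (X → ℝ)) =>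
      ∑ a, ((1 + w.1) * Real.negMulLog ((w.1 * w.2.1 a + w.2.2 a) / (1 + w.1))
        - w.1 * Real.negMulLog (w.2.1 a) - Real.negMulLog (w.2.2 a))) (α, z) := by
    intro z
    have hα1 : (1 + α) ≠ 0 := by positivity
    refine tendsto_finsetSum _ fun a _ => ?_
    have hdiv : ContinuousAt (fun w : ℝ × ((X → ℝ) × (X → ℝ)) =>
        (w.1 * w.2.1 a + w.2.2 a) / (1 + w.1)) (α, z) :=
      ContinuousAt.div (by fun_prop) (by fun_prop) hα1
    have h1 := Real.continuous_negMulLog.continuousAt.comp hdiv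
    have h2 : Continuous fun w : ℝ × ((X → ℝ) × (X → ℝ)) => Real.negMulLog (w.2.1 a) :=
      Real.continuous_negMulLog.comp (by fun_prop)
    have h3 : Continuous fun w : ℝ × ((X → ℝ) × (X → ℝ)) => Real.negMulLog (w.2.2 a) :=
      Real.continuous_negMulLog.comp (by fun_prop)
    have h4 : ContinuousAt (fun w : ℝ × ((X → ℝ) × (X → ℝ)) => 1 + w.1) (α, z) := by fun_prop
    exact ((h4.mul h1).sub (continuousAt_fst.mul h2.continuousAt)).sub h3.continuousAt
  have hV : Continuous fun w : ℝ × ((X → ℝ) × (X → ℝ)) =>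
      relEnt w.2.2 R₂ + w.1 * relEnt w.2.1 R₁ :=
    ((continuous_relEnt_left R₂).comp (by fun_prop)).add
      (continuous_fst.mul ((continuous_relEnt_left R₁).comp (by fun_prop)))
  have key := ((isCompact_stdSimplex ℝ X).prod
    (isCompact_stdSimplex ℝ X)).eventually_forall_of_forall_eventually (x₀ := α)
    (P := fun c z =>
      ∑ a, ((1 + c) * Real.negMulLog ((c * z.1 a + z.2 a) / (1 + c))
        - c * Real.negMulLog (z.1 a) - Real.negMulLog (z.2 a)) < lam →
      sInf (exponentValues α lam R₁ R₂) - δ < relEnt z.2 R₂ + c * relEnt z.1 R₁) ?_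
  · filter_upwards [key, lt_mem_nhds hα] with c hkey hc p hp q hq hG
    refine hkey (p, q) ⟨hp, hq⟩ ?_
    rwa [genJS_eq_sum_negMulLog hc hp.1 hq.1] at hG
  · rintro z ⟨hp, hq⟩
    rcases le_or_gt (genJS α z.1 z.2) lam with h | h
    · have hle := sInf_exponentValues_le hα hlam R₁ R₂ hp hq h
      have := (hV.continuousAt (x := (α, z))).eventually_const_lt
        (u := sInf (exponentValues α lam R₁ R₂) - δ) (by dsimp only; linarith)
      filter_upwards [this] with w hw _ using hw
    · rw [genJS_eq_sum_negMulLog hα hp.1 hq.1] at h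
      filter_upwards [(hJ z).eventually_const_lt h] with w hw hw'
      exact absurd hw' hw.not_gt

/-- For distributions with disjoint supports the conventions of `Real.log` make the exponent
nonpositive. -/
theorem sInf_exponentValues_nonpos {α lam : ℝ} (hα : 0 < α) (hlam : 0 < lam) {P₁ P₂ : X → ℝ}
    (h₂ : ∀ a, 0 ≤ P₂ a) (h₂sum : ∑ a, P₂ a = 1) (hdisj : ∀ a, P₁ a = 0 ∨ P₂ a = 0) :
    sInf (exponentValues α lam P₁ P₂) ≤ 0 := by
  refine csInf_le (bddBelow_exponentValues α lam P₁ P₂)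
    ⟨P₂, P₂, h₂, h₂sum, h₂, h₂sum, by rwa [genJS_self hα h₂], ?_⟩
  have h1 : relEnt P₂ P₂ = 0 := Finset.sum_eq_zero fun a _ => by
    by_cases h : P₂ a = 0 <;> simp [h]
  have h2 : relEnt P₂ P₁ = 0 := Finset.sum_eq_zero fun a _ => by
    rcases hdisj a with h | h <;> simp [h]
  simp [h1, h2]

end Divergence

section Types

theorem sum_prod_eq_pow_sum {X : Type*} [Fintype X] (m : ℕ) (r : X → ℝ) :
    ∑ x : Fin m → X, ∏ j, r (x j) = (∑ a, r a) ^ m := by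
  have := Finset.prod_univ_sum (fun _ : Fin m => (Finset.univ : Finset X)) (fun _ a => r a)
  simpa using this.symm

theorem empirical_nonneg {X : Type*} [DecidableEq X] (m : ℕ) (x : Fin m → X) (a : X) : 0 ≤ empirical m x a := by
  unfold empirical; positivity

variable {X : Type*} [Fintype X] [DecidableEq X]

theorem sum_comp_eq_sum_card_mul {m : ℕ} (x : Fin m → X) (f : X → ℝ) :
    ∑ j, f (x j) = ∑ a, ((Finset.univ.filter fun i => x i = a).card : ℝ) * f a := by
  rw [← Finset.sum_fiberwise (s := Finset.univ) (g := x)]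
  refine Finset.sum_congr rfl fun a _ => ?_
  rw [Finset.sum_congr rfl (g := fun _ => f a) (by intro i hi; rw [(Finset.mem_filter.1 hi).2])]
  simp

theorem sum_empirical {m : ℕ} (hm : m ≠ 0) (x : Fin m → X) : ∑ a, empirical m x a = 1 := by
  have h := sum_comp_eq_sum_card_mul x (fun _ => 1)
  simp only [mul_one, Finset.sum_const, Finset.card_univ, Fintype.card_fin, nsmul_eq_mul] at h
  unfold empirical
  rw [← Finset.sum_div, ← h, div_self (by exact_mod_cast hm)]

theorem empirical_mem_stdSimplex {m : ℕ} (hm : m ≠ 0) (x : Fin m → X) :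
    empirical m x ∈ stdSimplex ℝ X :=
  ⟨empirical_nonneg m x, sum_empirical hm x⟩

theorem prod_le_exp_mul_prod_empirical {m : ℕ} (x : Fin m → X) {r : X → ℝ} (hr : ∀ a, 0 ≤ r a) :
    ∏ j, r (x j) ≤ Real.exp (-(m * relEnt (empirical m x) r)) * ∏ j, empirical m x (x j) := by
  by_cases h0 : ∃ j, r (x j) = 0
  · obtain ⟨j, hj⟩ := h0
    rw [Finset.prod_eq_zero (Finset.mem_univ j) hj]
    exact mul_nonneg (Real.exp_pos _).le (Finset.prod_nonneg fun j _ => empirical_nonneg _ _ _)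
  · push Not at h0
    have hrpos : ∀ j, 0 < r (x j) := fun j => (hr _).lt_of_ne' (h0 j)
    have hm : (m : ℝ) * relEnt (empirical m x) r =
        ∑ j, Real.log (empirical m x (x j) / r (x j)) := by
      rw [sum_comp_eq_sum_card_mul x fun a => Real.log (empirical m x a / r a), relEnt,
        Finset.mul_sum]
      refine Finset.sum_congr rfl fun a _ => ?_
      rw [← mul_assoc]
      congr 1
      rcases Nat.eq_zero_or_pos m with rfl | hm
      · simp
      · unfold empirical
        field_simp
    have hepos : ∀ j, 0 < empirical m x (x j) := by
      intro j
      have hcard : 0 < (Finset.univ.filter fun i => x i = x j).card :=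
        Finset.card_pos.2 ⟨j, by simp⟩
      have : 0 < m := j.pos
      unfold empirical
      positivity
    rw [hm, ← Finset.sum_neg_distrib, Real.exp_sum, ← Finset.prod_mul_distrib]
    refine le_of_eq (Finset.prod_congr rfl fun j _ => ?_)
    rw [Real.exp_neg, Real.exp_log (div_pos (hepos j) (hrpos j))]
    have := (hepos j).ne'
    field_simp

/-- The method of types: there are at most `(m + 1) ^ |X|` empirical distributions. -/
theorem sum_prod_empirical_le (m : ℕ) :
    ∑ x : Fin m → X, ∏ j, empirical m x (x j) ≤ ((m : ℝ) + 1) ^ Fintype.card X := by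
  let cnt : (Fin m → X) → X → Fin (m + 1) := fun x a =>
    ⟨(Finset.univ.filter fun i => x i = a).card,
      Nat.lt_succ_of_le ((Finset.card_le_univ _).trans (by simp))⟩
  rw [← Finset.sum_fiberwise (s := Finset.univ) (g := cnt)]
  refine (Finset.sum_le_sum (g := fun _ => (1 : ℝ)) fun t _ => ?_).trans ?_
  · by_cases ht : ∃ y, cnt y = t
    · obtain ⟨y, rfl⟩ := ht
      have heq : ∀ x ∈ Finset.univ.filter (fun x => cnt x = cnt y),
          ∏ j, empirical m x (x j) = ∏ j, empirical m y (x j) := by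
        intro x hx
        have hx' := (Finset.mem_filter.1 hx).2
        refine Finset.prod_congr rfl fun j _ => ?_
        have := congrArg Fin.val (congrFun hx' (x j))
        simp only [cnt] at this
        simp only [empirical, this]
      rw [Finset.sum_congr rfl heq]
      refine (Finset.sum_le_sum_of_subset_of_nonneg (Finset.filter_subset _ _)
        fun x _ _ => Finset.prod_nonneg fun j _ => empirical_nonneg _ _ _).trans ?_
      rw [sum_prod_eq_pow_sum]
      rcases eq_or_ne m 0 with rfl | hm
      · simp
      · rw [sum_empirical hm, one_pow]
    · push Not at ht
      rw [Finset.filter_false_of_mem fun x _ => ht x]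
      simp
  · simp

/-- Sanov-type upper bound for a pair of independent samples. -/
theorem sum_sum_ite_prod_le (M n : ℕ) {R₁ R₂ : X → ℝ} (h₁ : ∀ a, 0 ≤ R₁ a)
    (h₂ : ∀ a, 0 ≤ R₂ a) (A : (Fin M → X) → (Fin n → X) → Prop) [∀ x y, Decidable (A x y)]
    (B : ℝ) (hB : ∀ x y, A x y →
      B ≤ M * relEnt (empirical M x) R₁ + n * relEnt (empirical n y) R₂) :
    (∑ x : Fin M → X, ∑ y : Fin n → X,
      if A x y then (∏ j, R₁ (x j)) * ∏ j, R₂ (y j) else 0) ≤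
    Real.exp (-B) * (((M : ℝ) + 1) ^ Fintype.card X * ((n : ℝ) + 1) ^ Fintype.card X) := by
  have hE : ∀ (m : ℕ) (x : Fin m → X), 0 ≤ ∏ j, empirical m x (x j) := fun m x =>
    Finset.prod_nonneg fun j _ => empirical_nonneg _ _ _
  calc _ ≤ ∑ x : Fin M → X, ∑ y : Fin n → X, Real.exp (-B) *
        ((∏ j, empirical M x (x j)) * ∏ j, empirical n y (y j)) := by
        refine Finset.sum_le_sum fun x _ => Finset.sum_le_sum fun y _ => ?_
        have hpos := mul_nonneg (hE M x) (hE n y)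
        split_ifs with hA
        · refine (mul_le_mul (prod_le_exp_mul_prod_empirical x h₁)
            (prod_le_exp_mul_prod_empirical y h₂) (Finset.prod_nonneg fun j _ => h₂ _)
            (mul_nonneg (Real.exp_pos _).le (hE M x))).trans ?_
          rw [mul_mul_mul_comm, ← Real.exp_add]
          refine mul_le_mul_of_nonneg_right (Real.exp_le_exp.2 ?_) hpos
          linarith [hB x y hA]
        · exact mul_nonneg (Real.exp_pos _).le hpos
    _ = Real.exp (-B) * ((∑ x : Fin M → X, ∏ j, empirical M x (x j)) *
        ∑ y : Fin n → X, ∏ j, empirical n y (y j)) := by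
        rw [Finset.sum_mul_sum, Finset.mul_sum]
        simp only [Finset.mul_sum]
    _ ≤ _ := by
        refine mul_le_mul_of_nonneg_left ?_ (Real.exp_pos _).le
        exact mul_le_mul (sum_prod_empirical_le M) (sum_prod_empirical_le n)
          (Finset.sum_nonneg fun y _ => hE n y) (by positivity)

theorem genJS_empirical_const {c : ℝ} (hc : 0 < c) {M n : ℕ} (hM : M ≠ 0) (hn : n ≠ 0) (a : X) :
    genJS c (empirical M fun _ => a) (empirical n fun _ => a) = 0 := by
  have h : ∀ {m : ℕ}, m ≠ 0 →
      (empirical m fun _ => a) = fun b => if a = b then (1 : ℝ) else 0 := by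
    intro m hm
    funext b
    by_cases hab : a = b <;> simp [empirical, hab, hm]
  rw [h hM, h hn]
  exact genJS_self hc fun b => by split_ifs <;> norm_num

end Types

theorem sum_sum_sum_ite_le {ι κ τ : Type*} [Fintype ι] [Fintype κ] [Fintype τ]
    {f : ι → ℝ} {g : κ → ℝ} {h : τ → ℝ} (hf : ∀ i, 0 ≤ f i) (hg : ∀ j, 0 ≤ g j)
    (hh : ∀ t, 0 ≤ h t) (hf1 : ∑ i, f i = 1) (A : ι → τ → Prop) (B : κ → τ → Prop)
    [∀ i t, Decidable (A i t)] [∀ j t, Decidable (B j t)] :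
    (∑ i, ∑ j, ∑ t, if A i t ∧ B j t then f i * g j * h t else 0) ≤
      ∑ j, ∑ t, if B j t then g j * h t else 0 := by
  calc _ ≤ ∑ i, f i * ∑ j, ∑ t, if B j t then g j * h t else 0 := by
        refine Finset.sum_le_sum fun i _ => ?_
        simp only [Finset.mul_sum]
        refine Finset.sum_le_sum fun j _ => Finset.sum_le_sum fun t _ => ?_
        have := mul_nonneg (hg j) (hh t)
        by_cases hB : B j t
        · by_cases hA : A i t
          · simp [hA, hB, mul_assoc]
          · simpa [hA, hB] using mul_nonneg (hf i) this
        · simp [hB]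
    _ = _ := by rw [← Finset.sum_mul, hf1, one_mul]

theorem le_sum_sum_sum {ι κ τ : Type*} [Fintype ι] [Fintype κ] [Fintype τ]
    {f : ι → κ → τ → ℝ} (hf : ∀ i j t, 0 ≤ f i j t) (i : ι) (j : κ) (t : τ) :
    f i j t ≤ ∑ i, ∑ j, ∑ t, f i j t :=
  calc f i j t ≤ ∑ t, f i j t :=
        Finset.single_le_sum (f := fun t => f i j t) (fun t _ => hf i j t) (Finset.mem_univ t)
    _ ≤ ∑ j, ∑ t, f i j t :=
        Finset.single_le_sum (f := fun j => ∑ t, f i j t)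
          (fun j _ => Finset.sum_nonneg fun t _ => hf i j t) (Finset.mem_univ j)
    _ ≤ _ := Finset.single_le_sum (f := fun i => ∑ j, ∑ t, f i j t)
          (fun i _ => Finset.sum_nonneg fun j _ => Finset.sum_nonneg fun t _ => hf i j t)
          (Finset.mem_univ i)

/-- An upper bound for a real `limsup` that, when the sequence is not eventually bounded below,
relies on the default value `0`. -/
theorem limsup_le_of_forall_eventually_le {u : ℕ → ℝ} {L : ℝ}
    (h : ∀ η > 0, ∀ᶠ n in atTop, u n ≤ L + η) (hL : (∃ b, ∀ᶠ n in atTop, b ≤ u n) ∨ 0 ≤ L) :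
    limsup u atTop ≤ L := by
  rw [limsup_eq]
  by_cases hb : BddBelow {a | ∀ᶠ n in atTop, u n ≤ a}
  · exact le_of_forall_pos_le_add fun η hη => csInf_le hb (h η hη)
  · rcases hL with ⟨b, hbu⟩ | hL
    · refine absurd ⟨b, fun a ha => ?_⟩ hb
      obtain ⟨n, h1, h2⟩ := (hbu.and ha).exists
      exact h1.trans h2
    · rwa [Real.sInf_of_not_bddBelow hb]

/-- Polynomial factors do not affect exponential rates. -/
theorem tendsto_log_poly_div {α : ℝ} {N : ℕ → ℕ}
    (hN : Tendsto (fun n => (N n : ℝ) / n) atTop (𝓝 α)) (k : ℕ) :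
    Tendsto (fun n : ℕ => Real.log (((N n : ℝ) + 1) ^ k * ((n : ℝ) + 1) ^ k) / n)
      atTop (𝓝 0) := by
  have hlog : Tendsto (fun n : ℕ => Real.log n / n) atTop (𝓝 0) :=
    (Real.isLittleO_log_id_atTop.tendsto_div_nhds_zero).comp tendsto_natCast_atTop_atTop
  have hinv : Tendsto (fun n : ℕ => ((n : ℝ))⁻¹) atTop (𝓝 0) := tendsto_inv_atTop_nhds_zero_nat
  have hup : Tendsto (fun n : ℕ => (k : ℝ) * ((Real.log (|α| + 2) * (n : ℝ)⁻¹ + Real.log n / n) +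
      (Real.log 2 * (n : ℝ)⁻¹ + Real.log n / n))) atTop (𝓝 0) := by
    have := (((hinv.const_mul (Real.log (|α| + 2))).add hlog).add
      ((hinv.const_mul (Real.log 2)).add hlog)).const_mul (k : ℝ)
    simpa using this
  refine tendsto_of_tendsto_of_tendsto_of_le_of_le' tendsto_const_nhds hup ?_ ?_
  · refine Eventually.of_forall fun n => div_nonneg (Real.log_nonneg ?_) (Nat.cast_nonneg n)
    have h1 : (1 : ℝ) ≤ (N n : ℝ) + 1 := by simp
    have h2 : (1 : ℝ) ≤ (n : ℝ) + 1 := by simp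
    exact one_le_mul_of_one_le_of_one_le (one_le_pow₀ h1) (one_le_pow₀ h2)
  · filter_upwards [eventually_gt_atTop 0,
      hN.eventually_lt_const (show α < |α| + 1 by linarith [le_abs_self α])] with n hn hNn
    have hn' : (0 : ℝ) < n := by exact_mod_cast hn
    have hn1 : (1 : ℝ) ≤ n := by exact_mod_cast hn
    rw [div_lt_iff₀ hn'] at hNn
    have h1 : Real.log ((N n : ℝ) + 1) ≤ Real.log (|α| + 2) + Real.log n := by
      rw [← Real.log_mul (by positivity) hn'.ne']
      exact Real.log_le_log (by positivity) (by linarith)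
    have h2 : Real.log ((n : ℝ) + 1) ≤ Real.log 2 + Real.log n := by
      rw [← Real.log_mul (by norm_num) hn'.ne']
      exact Real.log_le_log (by positivity) (by linarith)
    rw [Real.log_mul (by positivity) (by positivity), Real.log_pow, Real.log_pow,
      div_le_iff₀ hn']
    have hk : (0 : ℝ) ≤ k := Nat.cast_nonneg k
    calc _ = (k : ℝ) * (Real.log ((N n : ℝ) + 1) + Real.log ((n : ℝ) + 1)) := by ring
      _ ≤ k * ((Real.log (|α| + 2) + Real.log n) + (Real.log 2 + Real.log n)) := by gcongr
      _ = _ := by field_simp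

section Gutman

variable {X : Type*} [Fintype X] [DecidableEq X]

open Classical in
/-- The probability, when the training samples of length `M` are drawn from `P₁` and `P₂` and the
test sample of length `n` from `R`, that both hypotheses are within divergence `lam`. -/
noncomputable def bothProb (lam : ℝ) (P₁ P₂ R : X → ℝ) (M n : ℕ) : ℝ :=
  ∑ x₁ : Fin M → X, ∑ x₂ : Fin M → X, ∑ xt : Fin n → X,
    if genJS ((M : ℝ) / n) (empirical M x₁) (empirical n xt) < lam ∧
       genJS ((M : ℝ) / n) (empirical M x₂) (empirical n xt) < lam
    then (∏ j, P₁ (x₁ j)) * (∏ j, P₂ (x₂ j)) * (∏ j, R (xt j)) else 0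

theorem bothProb_swap (lam : ℝ) (P₁ P₂ R : X → ℝ) (M n : ℕ) :
    bothProb lam P₁ P₂ R M n = bothProb lam P₂ P₁ R M n := by
  unfold bothProb
  rw [Finset.sum_comm]
  simp only [and_comm, mul_comm]

theorem bothProb_nonneg {lam : ℝ} {P₁ P₂ R : X → ℝ} (h₁ : ∀ a, 0 ≤ P₁ a) (h₂ : ∀ a, 0 ≤ P₂ a)
    (hR : ∀ a, 0 ≤ R a) (M n : ℕ) : 0 ≤ bothProb lam P₁ P₂ R M n := by
  refine Finset.sum_nonneg fun x₁ _ => Finset.sum_nonneg fun x₂ _ =>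
    Finset.sum_nonneg fun xt _ => ?_
  have := Finset.prod_nonneg fun j (_ : j ∈ Finset.univ) => h₁ (x₁ j)
  have := Finset.prod_nonneg fun j (_ : j ∈ Finset.univ) => h₂ (x₂ j)
  have := Finset.prod_nonneg fun j (_ : j ∈ Finset.univ) => hR (xt j)
  split_ifs <;> positivity

theorem eventually_bothProb_le {α lam : ℝ} (hα : 0 < α) (hlam : 0 < lam) {P₁ P₂ R : X → ℝ}
    (h₁ : ∀ a, 0 ≤ P₁ a) (h₁sum : ∑ a, P₁ a = 1) (h₂ : ∀ a, 0 ≤ P₂ a) (hR : ∀ a, 0 ≤ R a)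
    {N : ℕ → ℕ} (hN : Tendsto (fun n => (N n : ℝ) / n) atTop (𝓝 α)) {m : ℝ}
    (hm : m ≤ sInf (exponentValues α lam P₂ R)) {δ : ℝ} (hδ : 0 < δ) :
    ∀ᶠ n : ℕ in atTop, bothProb lam P₁ P₂ R (N n) n ≤ Real.exp (-(n * (m - δ))) *
      (((N n : ℝ) + 1) ^ Fintype.card X * ((n : ℝ) + 1) ^ Fintype.card X) := by
  classical
  filter_upwards [hN.eventually (eventually_lt_relEnt_add hα hlam P₂ R hδ),
    eventually_gt_atTop 0, hN.eventually_const_lt hα] with n hev hn hNpos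
  have hn' : (0 : ℝ) < n := by exact_mod_cast hn
  have hN0 : N n ≠ 0 := fun h => by simp [h] at hNpos
  have hprod : ∀ {r : X → ℝ} (_ : ∀ a, 0 ≤ r a) {k : ℕ} (x : Fin k → X), 0 ≤ ∏ j, r (x j) :=
    fun hr _ _ => Finset.prod_nonneg fun _ _ => hr _
  refine le_trans ?_ (sum_sum_ite_prod_le (N n) n h₂ hR (fun x y =>
    genJS ((N n : ℝ) / n) (empirical (N n) x) (empirical n y) < lam) _ fun x y hxy => ?_)
  · have := sum_sum_sum_ite_le (hprod h₁ (k := N n)) (hprod h₂ (k := N n)) (hprod hR (k := n))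
      (by rw [sum_prod_eq_pow_sum, h₁sum, one_pow])
      (fun x y => genJS ((N n : ℝ) / n) (empirical (N n) x) (empirical n y) < lam)
      (fun x y => genJS ((N n : ℝ) / n) (empirical (N n) x) (empirical n y) < lam)
    unfold bothProb
    convert this using 8
  · have := hev _ (empirical_mem_stdSimplex hN0 x) _ (empirical_mem_stdSimplex hn.ne' y) hxy
    calc (n : ℝ) * (m - δ) ≤ n * (relEnt (empirical n y) R +
          (N n : ℝ) / n * relEnt (empirical (N n) x) P₂) := by
          refine mul_le_mul_of_nonneg_left ?_ hn'.le
          linarith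
      _ = _ := by field_simp; ring

/-- The contribution of constant sequences at a common atom. -/
theorem pow_le_bothProb {lam : ℝ} (hlam : 0 < lam) {P₁ P₂ R : X → ℝ} (h₁ : ∀ a, 0 ≤ P₁ a)
    (h₂ : ∀ a, 0 ≤ P₂ a) (hR : ∀ a, 0 ≤ R a) {M n : ℕ} (hM : M ≠ 0) (hn : n ≠ 0)
    {s : ℝ} (hs : 0 ≤ s) {a : X} (hs₁ : s ≤ P₁ a) (hs₂ : s ≤ P₂ a) (hsR : s ≤ R a) :
    s ^ (2 * M + n) ≤ bothProb lam P₁ P₂ R M n := by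
  classical
  have hle := le_sum_sum_sum (f := fun (x₁ x₂ : Fin M → X) (xt : Fin n → X) =>
    if genJS ((M : ℝ) / n) (empirical M x₁) (empirical n xt) < lam ∧
       genJS ((M : ℝ) / n) (empirical M x₂) (empirical n xt) < lam
    then (∏ j, P₁ (x₁ j)) * (∏ j, P₂ (x₂ j)) * (∏ j, R (xt j)) else 0) ?_
    (fun _ => a) (fun _ => a) (fun _ => a)
  · have hc : (0 : ℝ) < (M : ℝ) / n := by positivity
    simp only [genJS_empirical_const hc hM hn, hlam, and_self, if_true, Finset.prod_const,
      Finset.card_univ, Fintype.card_fin] at hle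
    have hpow : s ^ (2 * M + n) ≤ P₁ a ^ M * P₂ a ^ M * R a ^ n := by
      rw [pow_add, two_mul, pow_add]
      have := h₁ a
      have := h₂ a
      gcongr
    refine hpow.trans (hle.trans_eq ?_)
    unfold bothProb
    congr!
  · intro x₁ x₂ xt
    have := Finset.prod_nonneg fun j (_ : j ∈ Finset.univ) => h₁ (x₁ j)
    have := Finset.prod_nonneg fun j (_ : j ∈ Finset.univ) => h₂ (x₂ j)
    have := Finset.prod_nonneg fun j (_ : j ∈ Finset.univ) => hR (xt j)
    split_ifs <;> positivity

/-- The probability that both hypotheses are kept decays at least at the smaller of the two rates. -/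
theorem limsup_log_bothProb_le {α lam : ℝ} (hα : 0 < α) (hlam : 0 < lam) {P₁ P₂ : X → ℝ}
    (h₁ : ∀ a, 0 ≤ P₁ a) (h₁sum : ∑ a, P₁ a = 1) (h₂ : ∀ a, 0 ≤ P₂ a) (h₂sum : ∑ a, P₂ a = 1)
    {π₁ π₂ : ℝ} (hπ₁ : 0 ≤ π₁) (hπ₂ : 0 ≤ π₂) (hπ : π₁ + π₂ = 1)
    {N : ℕ → ℕ} (hN : Tendsto (fun n => (N n : ℝ) / n) atTop (𝓝 α)) :
    limsup (fun n : ℕ => Real.log (π₁ * bothProb lam P₁ P₂ P₁ (N n) n +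
      π₂ * bothProb lam P₁ P₂ P₂ (N n) n) / n) atTop ≤
      -min (sInf (exponentValues α lam P₁ P₂)) (sInf (exponentValues α lam P₂ P₁)) := by
  set m := min (sInf (exponentValues α lam P₁ P₂)) (sInf (exponentValues α lam P₂ P₁))
  set Q : ℕ → ℝ := fun n => π₁ * bothProb lam P₁ P₂ P₁ (N n) n +
      π₂ * bothProb lam P₁ P₂ P₂ (N n) n
  have hQnn : ∀ n, 0 ≤ Q n := fun n => add_nonneg
    (mul_nonneg hπ₁ (bothProb_nonneg h₁ h₂ h₁ _ _)) (mul_nonneg hπ₂ (bothProb_nonneg h₁ h₂ h₂ _ _))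
  have hup : ∀ η > 0, ∀ᶠ n : ℕ in atTop, 0 < Q n → Real.log (Q n) / n ≤ -m + η := by
    intro η hη
    have e1 := eventually_bothProb_le hα hlam h₁ h₁sum h₂ h₁ hN (min_le_right _ _ : m ≤ _)
      (half_pos hη)
    have e2 := eventually_bothProb_le hα hlam h₂ h₂sum h₁ h₂ hN (min_le_left _ _ : m ≤ _)
      (half_pos hη)
    filter_upwards [e1, e2, eventually_gt_atTop 0,
      (tendsto_log_poly_div hN (Fintype.card X)).eventually_lt_const (half_pos hη)]
      with n he1 he2 hn hpoly hQpos
    have hn' : (0 : ℝ) < n := by exact_mod_cast hn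
    rw [bothProb_swap] at he2
    have hQle : Q n ≤ Real.exp (-(n * (m - η / 2))) *
        (((N n : ℝ) + 1) ^ Fintype.card X * ((n : ℝ) + 1) ^ Fintype.card X) := by
      refine (add_le_add (mul_le_mul_of_nonneg_left he1 hπ₁)
        (mul_le_mul_of_nonneg_left he2 hπ₂)).trans_eq ?_
      rw [← add_mul, hπ, one_mul]
    have hlog := Real.log_le_log hQpos hQle
    rw [Real.log_mul (Real.exp_pos _).ne' (by positivity), Real.log_exp] at hlog
    rw [div_lt_iff₀ hn'] at hpoly
    rw [div_le_iff₀ hn']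
    nlinarith
  by_cases hcommon : ∃ a, 0 < P₁ a ∧ 0 < P₂ a
  · obtain ⟨a, ha₁, ha₂⟩ := hcommon
    set s := min (P₁ a) (P₂ a)
    have hs : 0 < s := lt_min ha₁ ha₂
    have hlow : ∀ᶠ n : ℕ in atTop, s ^ (2 * N n + n) ≤ Q n := by
      filter_upwards [eventually_gt_atTop 0, hN.eventually_const_lt hα] with n hn hNpos
      have hN0 : N n ≠ 0 := fun h => by simp [h] at hNpos
      have b1 := pow_le_bothProb hlam h₁ h₂ h₁ hN0 hn.ne' hs.le (min_le_left _ _)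
        (min_le_right _ _) (min_le_left (P₁ a) (P₂ a))
      have b2 := pow_le_bothProb hlam h₁ h₂ h₂ hN0 hn.ne' hs.le (min_le_left _ _)
        (min_le_right _ _) (min_le_right (P₁ a) (P₂ a))
      calc s ^ (2 * N n + n) = π₁ * s ^ (2 * N n + n) + π₂ * s ^ (2 * N n + n) := by
            rw [← add_mul, hπ, one_mul]
        _ ≤ Q n := add_le_add (mul_le_mul_of_nonneg_left b1 hπ₁) (mul_le_mul_of_nonneg_left b2 hπ₂)
    refine limsup_le_of_forall_eventually_le (fun η hη => ?_) (Or.inl ?_)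
    · filter_upwards [hup η hη, hlow] with n h1 h2 using h1 ((pow_pos hs _).trans_le h2)
    · have hlim : Tendsto (fun n : ℕ => (2 * ((N n : ℝ) / n) + 1) * Real.log s) atTop
          (𝓝 ((2 * α + 1) * Real.log s)) := ((hN.const_mul 2).add_const 1).mul_const _
      refine ⟨(2 * α + 1) * Real.log s - 1, ?_⟩
      filter_upwards [hlow, eventually_gt_atTop 0, hlim.eventually_const_lt (sub_one_lt _)]
        with n h1 hn h2
      have hn' : (0 : ℝ) < n := by exact_mod_cast hn
      refine h2.le.trans ?_
      have := Real.log_le_log (pow_pos hs _) h1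
      rw [Real.log_pow] at this
      rw [le_div_iff₀ hn']
      refine le_trans (le_of_eq ?_) this
      push_cast
      field_simp
  · push Not at hcommon
    have hm : m ≤ 0 := (min_le_left _ _).trans <|
      sInf_exponentValues_nonpos hα hlam h₂ h₂sum fun a => by
        rcases (h₁ a).eq_or_lt with h | h
        · exact Or.inl h.symm
        · exact Or.inr ((hcommon a h).antisymm (h₂ a))
    refine limsup_le_of_forall_eventually_le (fun η hη => ?_) (Or.inr (by linarith))
    filter_upwards [hup η hη] with n h
    rcases (hQnn n).eq_or_lt with h0 | h0
    · change Real.log (Q n) / n ≤ -m + η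
      rw [← h0, Real.log_zero, zero_div]; linarith
    · exact h h0

end Gutman


/-- **probability of a two-element prediction set, binary Gutman test
with confidence.** With threshold `λ`, training sets of size `N = α·n` (formalized as
`N(n)/n → α`), priors `π₁, π₂`, and prediction set
`Γ_n = {H_i : GJS(T_{X_i}, T_{X_test}, N/n) < λ}`,
`limsup_n (1/n)·log P(|Γ_n| = 2) ≤ −min(F(P₁,P₂,α,λ), F(P₂,P₁,α,λ))`, where
`F(P₁,P₂,α,λ) = inf { D(Q₂‖P₂) + α·D(Q₁‖P₁) : Q₁,Q₂ distributions, GJS(Q₁,Q₂,α) < λ }`. -/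
theorem gutman_confidence_full_set_exponent_binary
    {X : Type*} [Fintype X] [DecidableEq X]
    (P₁ P₂ : X → ℝ)
    (h₁nonneg : ∀ a, 0 ≤ P₁ a) (h₁sum : ∑ a, P₁ a = 1)
    (h₂nonneg : ∀ a, 0 ≤ P₂ a) (h₂sum : ∑ a, P₂ a = 1)
    (π₁ π₂ : ℝ) (hπ₁ : 0 ≤ π₁) (hπ₂ : 0 ≤ π₂) (hπ : π₁ + π₂ = 1)
    (α : ℝ) (hα : 0 < α)
    (N : ℕ → ℕ)
    (hN : Filter.Tendsto (fun n => (N n : ℝ) / n) Filter.atTop (nhds α))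
    (G : ℝ → (X → ℝ) → (X → ℝ) → ℝ)
    (hG : ∀ (c : ℝ) (p q : X → ℝ),
      G c p q = c * ∑ a, p a * Real.log (p a / ((c * p a + q a) / (1 + c))) +
                ∑ a, q a * Real.log (q a / ((c * p a + q a) / (1 + c))))
    (T : (m : ℕ) → (Fin m → X) → X → ℝ)
    (hT : ∀ m (x : Fin m → X) (a : X),
      T m x a = ((Finset.univ.filter fun i => x i = a).card : ℝ) / m)
    (lam : ℝ) (hlam : 0 < lam)
    (F : (X → ℝ) → (X → ℝ) → ℝ)
    (hF : ∀ R₁ R₂ : X → ℝ, F R₁ R₂ = sInf {r : ℝ | ∃ Q₁ Q₂ : X → ℝ,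
      (∀ a, 0 ≤ Q₁ a) ∧ (∑ a, Q₁ a = 1) ∧ (∀ a, 0 ≤ Q₂ a) ∧ (∑ a, Q₂ a = 1) ∧
      G α Q₁ Q₂ < lam ∧
      r = (∑ a, Q₂ a * Real.log (Q₂ a / R₂ a)) +
          α * ∑ a, Q₁ a * Real.log (Q₁ a / R₁ a)})
    (Pfull : ℕ → ℝ)
    (hPfull : ∀ n, Pfull n =
      π₁ * (∑ x₁ : Fin (N n) → X, ∑ x₂ : Fin (N n) → X, ∑ xt : Fin n → X,
        if G ((N n : ℝ) / n) (T (N n) x₁) (T n xt) < lam ∧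
           G ((N n : ℝ) / n) (T (N n) x₂) (T n xt) < lam
        then (∏ j, P₁ (x₁ j)) * (∏ j, P₂ (x₂ j)) * (∏ j, P₁ (xt j)) else 0) +
      π₂ * (∑ x₁ : Fin (N n) → X, ∑ x₂ : Fin (N n) → X, ∑ xt : Fin n → X,
        if G ((N n : ℝ) / n) (T (N n) x₁) (T n xt) < lam ∧
           G ((N n : ℝ) / n) (T (N n) x₂) (T n xt) < lam
        then (∏ j, P₁ (x₁ j)) * (∏ j, P₂ (x₂ j)) * (∏ j, P₂ (xt j)) else 0)) :
    Filter.limsup (fun n => Real.log (Pfull n) / n) Filter.atTop ≤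
      -min (F P₁ P₂) (F P₂ P₁) := by
  obtain rfl : G = genJS := by
    funext c p q; rw [hG]; rfl
  obtain rfl : T = empirical := by
    funext m x a; rw [hT]; rfl
  have hFe : ∀ R₁ R₂, F R₁ R₂ = sInf (exponentValues α lam R₁ R₂) := hF
  have hP : ∀ n, Pfull n = π₁ * bothProb lam P₁ P₂ P₁ (N n) n +
      π₂ * bothProb lam P₁ P₂ P₂ (N n) n := by
    intro n
    rw [hPfull]
    unfold bothProb
    congr!
  simp only [hP, hFe]
  exact limsup_log_bothProb_le hα hlam h₁nonneg h₁sum h₂nonneg h₂sum hπ₁ hπ₂ hπ hN
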